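/- Let m, n ≥ 1 be integers, α, β ∈ ℝ, and x ∈ ℂ with Re(x) > 0. Define F_{m,n}(x, α, β) := (−x)^n · ∫₀^∞ Li_m(e^{−xt} e^{2πiα}) · Li_n(e^{−t} e^{2πiβ}) dt (an absolutely convergent integral). Then F_{m,n+1}(x, α, β) = F_{m+1,n}(x, α, β) − (−x)^n · Li_{m+1}(e^{2πiα}) · Li_{n+1}(e^{2πiβ}). -/

import Mathlib

open Complex MeasureTheory Filter Topology Set Asymptotics

noncomputable section

/-- `e2pi θ = e^{2πiθ}`. -/
def e2pi (θ : ℝ) : ℂ := Complex.exp (2 * Real.pi * Complex.I * θ)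

/-- Polylogarithm of integer order: `Li 0 z = z/(1-z)`, `Li 1 z = -Log(1-z)`,
`Li m z = ∑_{n≥1} z^n/n^m` for `m ≥ 2`. -/
def Li : ℕ → ℂ → ℂ
  | 0, z => z / (1 - z)
  | 1, z => -Complex.log (1 - z)
  | (m+2), z => ∑' n : ℕ, z ^ (n+1) / ((n+1 : ℕ) : ℂ) ^ (m+2)

/-- `F_{m,n}(x, α, β) = (-x)^n ∫₀^∞ Li_m(e^{-xt} e^{2πiα}) Li_n(e^{-t} e^{2πiβ}) dt`. -/
def Fmn (m n : ℕ) (x : ℂ) (α β : ℝ) : ℂ :=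
  (-x) ^ n * ∫ t in Set.Ioi (0:ℝ),
    Li m (Complex.exp (-x * t) * e2pi α) * Li n (Complex.exp (-(t : ℂ)) * e2pi β)

lemma Li_hasSum (m : ℕ) (hm : 1 ≤ m) (z : ℂ) (hz : ‖z‖ < 1) :
    HasSum (fun k : ℕ => z ^ (k+1) / ((k+1 : ℕ) : ℂ) ^ m) (Li m z) := by
  obtain _ | _ | m := m
  · omega
  · have := Complex.hasSum_taylorSeries_neg_log' hz
    simpa [Li] using this
  · have h : Summable (fun k : ℕ => z ^ (k+1) / ((k+1 : ℕ) : ℂ) ^ (m+2)) := by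
      refine Summable.of_norm_bounded (g := fun k : ℕ => ‖z‖ ^ (k+1)) ?_ ?_
      · exact (summable_nat_add_iff 1).2 (summable_geometric_of_lt_one (norm_nonneg _) hz)
      · intro k
        rw [norm_div, norm_pow, norm_pow, Complex.norm_natCast]
        apply div_le_self (by positivity)
        apply one_le_pow₀
        push_cast
        linarith [(Nat.cast_nonneg k : (0:ℝ) ≤ k)]
    exact h.hasSum

lemma Li_norm_le (m : ℕ) (hm : 1 ≤ m) (z : ℂ) (hz : ‖z‖ < 1) :
    ‖Li m z‖ ≤ (Li 1 (‖z‖ : ℂ)).re := by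
  have h1 := Complex.hasSum_re (Li_hasSum 1 le_rfl (‖z‖ : ℂ) (by simpa using hz))
  have h2 := Li_hasSum m hm z hz
  rw [← h2.tsum_eq]
  refine tsum_of_norm_bounded h1 fun k => ?_
  have e : (((‖z‖ : ℂ) ^ (k+1) / ((k+1 : ℕ) : ℂ) ^ 1)).re = ‖z‖ ^ (k+1) / ((k+1 : ℕ) : ℝ) := by
    rw [pow_one, ← Complex.ofReal_pow, Complex.div_natCast_re, Complex.ofReal_re]
  rw [e, norm_div, norm_pow, norm_pow, Complex.norm_natCast]
  gcongr
  refine le_self_pow₀ ?_ (by omega)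
  push_cast
  linarith [(Nat.cast_nonneg k : (0:ℝ) ≤ k)]

lemma Li_contOn (m : ℕ) (hm : 1 ≤ m) : ContinuousOn (Li (m+1)) (Metric.closedBall 0 1) := by
  obtain ⟨m, rfl⟩ := Nat.exists_eq_add_of_le' hm
  change ContinuousOn (fun z => ∑' n : ℕ, z ^ (n+1) / ((n+1 : ℕ) : ℂ) ^ (m+2)) _
  refine continuousOn_tsum (u := fun k : ℕ => 1 / ((k+1 : ℕ) : ℝ) ^ 2) ?_ ?_ ?_
  · intro i
    fun_prop
  · exact (summable_nat_add_iff 1).2 (Real.summable_one_div_nat_pow.2 one_lt_two)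
  · intro k z hz
    rw [mem_closedBall_zero_iff] at hz
    rw [norm_div, norm_pow, norm_pow, Complex.norm_natCast]
    have : (1:ℝ) ≤ ((k+1 : ℕ) : ℝ) := by
      push_cast
      linarith [(Nat.cast_nonneg k : (0:ℝ) ≤ k)]
    gcongr
    · exact pow_le_one₀ (norm_nonneg _) hz
    · omega

lemma Li_hasDerivAt (m : ℕ) (hm : 1 ≤ m) (z : ℂ) (hz : ‖z‖ < 1) (hz0 : z ≠ 0) :
    HasDerivAt (Li (m+1)) (Li m z / z) z := by
  have hs : HasSum (fun k : ℕ => z ^ k / ((k+1 : ℕ) : ℂ) ^ m) (Li m z / z) := by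
    have := (Li_hasSum m hm z hz).div_const z
    refine this.congr_fun ?_
    intro k
    field_simp
    ring
  obtain ⟨m, rfl⟩ := Nat.exists_eq_add_of_le' hm
  rw [← hs.tsum_eq]
  obtain ⟨r, hr, hr1⟩ := exists_between hz
  have hr0 : 0 ≤ r := (norm_nonneg _).trans hr.le
  refine hasDerivAt_tsum_of_isPreconnected (u := fun k : ℕ => r ^ k) (t := Metric.ball 0 r)
    (g := fun (k : ℕ) (z : ℂ) => z ^ (k+1) / ((k+1 : ℕ) : ℂ) ^ (m+2))
    (g' := fun (k : ℕ) (z : ℂ) => z ^ k / ((k+1 : ℕ) : ℂ) ^ (m+1))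
    (y₀ := z)
    (summable_geometric_of_lt_one hr0 hr1) Metric.isOpen_ball
    (convex_ball _ _).isPreconnected ?_ ?_ (by simpa using hr)
    (Li_hasSum (m+2) (by omega) z hz).summable (by simpa using hr)
  · intro k y _
    have hk : ((k+1 : ℕ) : ℂ) ≠ 0 := Nat.cast_ne_zero.2 (by omega)
    have := (hasDerivAt_pow (k+1) y).div_const (((k+1 : ℕ) : ℂ) ^ (m+2))
    refine this.congr_deriv ?_
    rw [Nat.add_sub_cancel]
    field_simp
    ring
  · intro k y hy
    rw [mem_ball_zero_iff] at hy
    rw [norm_div, norm_pow, norm_pow, Complex.norm_natCast]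
    have : (1:ℝ) ≤ ((k+1 : ℕ) : ℝ) := by
      push_cast
      linarith [(Nat.cast_nonneg k : (0:ℝ) ≤ k)]
    refine (div_le_self (by positivity) (one_le_pow₀ this)).trans ?_
    gcongr

lemma Li_contAt (m : ℕ) (hm : 1 ≤ m) (z : ℂ) (hz : ‖z‖ < 1) : ContinuousAt (Li m) z := by
  obtain _ | _ | m := m
  · omega
  · change ContinuousAt (fun z => -Complex.log (1 - z)) z
    have : 1 - z ∈ Complex.slitPlane := by
      have := Complex.mem_slitPlane_of_norm_lt_one (z := -z) (by simpa using hz)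
      simpa [sub_eq_add_neg] using this
    exact ((continuousAt_const.sub continuousAt_id).clog this).neg
  · refine (Li_contOn (m+1) (by omega)).continuousAt ?_
    exact Filter.mem_of_superset (Metric.isOpen_ball.mem_nhds (by simpa using hz))
      Metric.ball_subset_closedBall

lemma arg_norm (x a : ℂ) (ha : ‖a‖ = 1) (t : ℝ) :
    ‖Complex.exp (-x * t) * a‖ = Real.exp (-x.re * t) := by
  rw [norm_mul, ha, mul_one, Complex.norm_exp]
  simp

lemma arg_norm_lt (x a : ℂ) (ha : ‖a‖ = 1) (hx : 0 < x.re) (t : ℝ) (ht : 0 < t) :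
    ‖Complex.exp (-x * t) * a‖ < 1 := by
  rw [arg_norm x a ha, Real.exp_lt_one_iff]
  nlinarith

lemma u_hasDerivAt (m : ℕ) (hm : 1 ≤ m) (x a : ℂ) (ha : ‖a‖ = 1) (hx : 0 < x.re)
    (t : ℝ) (ht : 0 < t) :
    HasDerivAt (fun t : ℝ => Li (m+1) (Complex.exp (-x * t) * a))
      (-x * Li m (Complex.exp (-x * t) * a)) t := by
  have ha0 : a ≠ 0 := by
    rintro rfl
    simp at ha
  have hz0 : Complex.exp (-x * t) * a ≠ 0 := mul_ne_zero (Complex.exp_ne_zero _) ha0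
  have h1 := Li_hasDerivAt m hm _ (arg_norm_lt x a ha hx t ht) hz0
  have h2 : HasDerivAt (fun t : ℝ => Complex.exp (-x * t) * a)
      (Complex.exp (-x * t) * (-x * 1) * a) t :=
    (((Complex.ofRealCLM.hasDerivAt (x := t)).const_mul (-x)).cexp).mul_const a
  have h3 := h1.comp t h2
  refine h3.congr_deriv ?_
  field_simp

lemma u_cont (m : ℕ) (hm : 1 ≤ m) (x a : ℂ) (ha : ‖a‖ = 1) (hx : 0 < x.re) :
    ContinuousOn (fun t : ℝ => Li m (Complex.exp (-x * t) * a)) (Set.Ioi 0) := by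
  intro t ht
  have h1 := Li_contAt m hm _ (arg_norm_lt x a ha hx t ht)
  have h2 : ContinuousAt (fun t : ℝ => Complex.exp (-x * t) * a) t := by fun_prop
  exact (ContinuousAt.comp (f := fun t : ℝ => Complex.exp (-x * t) * a) h1 h2).continuousWithinAt

lemma u_cont0 (m : ℕ) (hm : 1 ≤ m) (x a : ℂ) (ha : ‖a‖ = 1) (hx : 0 < x.re) :
    ContinuousWithinAt (fun t : ℝ => Li (m+1) (Complex.exp (-x * t) * a)) (Set.Ici 0) 0 := by
  have hmaps : MapsTo (fun t : ℝ => Complex.exp (-x * t) * a) (Set.Ici 0)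
      (Metric.closedBall 0 1) := by
    intro t ht
    have ht' : 0 ≤ t := ht
    rw [mem_closedBall_zero_iff, arg_norm x a ha, Real.exp_le_one_iff]
    nlinarith
  have h2 : ContinuousOn (fun t : ℝ => Complex.exp (-x * t) * a) (Set.Ici 0) := by fun_prop
  exact (Li_contOn m hm).comp h2 hmaps 0 self_mem_Ici

lemma u_tendsto (m : ℕ) (hm : 1 ≤ m) (x a : ℂ) (ha : ‖a‖ = 1) (hx : 0 < x.re) :
    Tendsto (fun t : ℝ => Li (m+1) (Complex.exp (-x * t) * a)) atTop (𝓝 0) := by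
  have h1 : Tendsto (fun t : ℝ => Complex.exp (-x * t) * a) atTop (𝓝 0) := by
    rw [tendsto_zero_iff_norm_tendsto_zero]
    simp_rw [arg_norm x a ha]
    exact Real.tendsto_exp_atBot.comp (tendsto_id.const_mul_atTop_of_neg (by linarith))
  have h2 := (Li_contAt (m+1) (by omega) 0 (by simp)).tendsto
  have h3 : Li (m+1) 0 = 0 := by
    rw [← (Li_hasSum (m+1) (by omega) 0 (by simp)).tsum_eq]
    simp
  rw [h3] at h2
  exact h2.comp h1

lemma bound_integrable (c : ℝ) (hc : 0 < c) :
    IntegrableOn (fun t : ℝ => (Li 1 ((Real.exp (-c * t) : ℝ) : ℂ)).re) (Set.Ioi 0) := by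
  have hc' : 0 < (c : ℂ).re := by simpa using hc
  have key : IntegrableOn (fun t : ℝ => c * (Li 1 ((Real.exp (-c * t) : ℝ) : ℂ)).re)
      (Set.Ioi 0) := by
    refine integrableOn_Ioi_deriv_of_nonneg (l := 0)
      (g := fun t : ℝ => -(Li 2 (Complex.exp (-(c:ℂ) * t) * 1)).re) ?_ ?_ ?_ ?_
    · exact (Complex.continuous_re.continuousAt.comp_continuousWithinAt
        (u_cont0 1 le_rfl c 1 (by simp) hc')).neg
    · intro t ht
      have h := (u_hasDerivAt 1 le_rfl c 1 (by simp) hc' t ht)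
      have h2 := (Complex.reCLM.hasFDerivAt.comp_hasDerivAt t h).neg
      refine h2.congr_deriv ?_
      simp [← Complex.ofReal_neg, ← Complex.ofReal_mul, -Complex.ofReal_exp, ← Complex.ofReal_exp]
    · intro t ht
      have ht' : 0 < t := ht
      refine mul_nonneg hc.le ?_
      have hlt : Real.exp (-c * t) < 1 := by
        rw [Real.exp_lt_one_iff]
        nlinarith
      have := Li_norm_le 1 le_rfl ((Real.exp (-c * t) : ℝ) : ℂ)
        (by rw [Complex.norm_of_nonneg (Real.exp_pos _).le]; exact hlt)
      rw [Complex.norm_of_nonneg (Real.exp_pos _).le] at this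
      exact (norm_nonneg _).trans this
    · have := ((Complex.continuous_re.tendsto 0).comp
        (u_tendsto 1 le_rfl c 1 (by simp) hc')).neg
      simpa using this
  have := key.const_mul c⁻¹
  refine this.congr (Filter.Eventually.of_forall fun t => ?_)
  simp only
  field_simp

lemma prod_integrable (m n : ℕ) (hm : 1 ≤ m) (hn : 1 ≤ n) (x y a b : ℂ) (ha : ‖a‖ = 1)
    (hb : ‖b‖ = 1) (hx : 0 < x.re) (hy : 0 < y.re) :
    IntegrableOn (fun t : ℝ => Li m (Complex.exp (-x * t) * a) *
      Li (n+1) (Complex.exp (-y * t) * b)) (Set.Ioi 0) := by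
  obtain ⟨C, hC⟩ := (isCompact_closedBall (0:ℂ) 1).exists_bound_of_continuousOn (Li_contOn n hn)
  refine Integrable.mono' ((bound_integrable x.re hx).mul_const C) ?_ ?_
  · exact ((u_cont m hm x a ha hx).mul
      (u_cont (n+1) (by omega) y b hb hy)).aestronglyMeasurable measurableSet_Ioi
  · refine (ae_restrict_iff' measurableSet_Ioi).2 (Filter.Eventually.of_forall fun t ht => ?_)
    rw [norm_mul]
    have h1 := Li_norm_le m hm _ (arg_norm_lt x a ha hx t ht)
    rw [arg_norm x a ha] at h1
    have h2 := hC (Complex.exp (-y * t) * b)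
      (by simpa using (arg_norm_lt y b hb hy t ht).le)
    exact mul_le_mul h1 h2 (norm_nonneg _) ((norm_nonneg _).trans h1)

lemma e2pi_norm (θ : ℝ) : ‖e2pi θ‖ = 1 := by
  rw [e2pi, Complex.norm_exp]
  simp

/-- The recurrence `F_{m,n+1}(x,α,β) = F_{m+1,n}(x,α,β) - (-x)^n Li_{m+1}(e^{2πiα})
Li_{n+1}(e^{2πiβ})`; the defining integrals converge absolutely. -/
theorem Fmn_recurrence (m n : ℕ) (hm : 1 ≤ m) (hn : 1 ≤ n) (α β : ℝ) (x : ℂ)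
    (hx : 0 < x.re) :
    IntegrableOn
      (fun t : ℝ =>
        Li m (Complex.exp (-x * t) * e2pi α) * Li (n + 1) (Complex.exp (-(t : ℂ)) * e2pi β))
      (Set.Ioi 0) ∧
    IntegrableOn
      (fun t : ℝ =>
        Li (m + 1) (Complex.exp (-x * t) * e2pi α) * Li n (Complex.exp (-(t : ℂ)) * e2pi β))
      (Set.Ioi 0) ∧
    Fmn m (n + 1) x α β
      = Fmn (m + 1) n x α β - (-x) ^ n * Li (m + 1) (e2pi α) * Li (n + 1) (e2pi β) := by
  have hα := e2pi_norm α
  have hβ := e2pi_norm β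
  have h1 : 0 < (1:ℂ).re := by simp
  have e1 : ∀ t : ℝ, Complex.exp (-(t:ℂ)) = Complex.exp (-1 * (t:ℂ)) := fun t => by
    rw [neg_one_mul]
  simp only [Fmn, e1]
  have I1 := prod_integrable m n hm hn x 1 _ _ hα hβ hx h1
  have I2 := prod_integrable n m hn hm 1 x _ _ hβ hα h1 hx
  simp only [mul_comm (Li n _)] at I2
  refine ⟨I1, I2, ?_⟩
  have key := integral_Ioi_of_hasDerivAt_of_tendsto
    (f := fun t : ℝ => Li (m+1) (Complex.exp (-x * t) * e2pi α) *
      Li (n+1) (Complex.exp (-1 * t) * e2pi β))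
    (f' := fun t : ℝ => -x * (Li m (Complex.exp (-x * t) * e2pi α) *
      Li (n+1) (Complex.exp (-1 * t) * e2pi β)) - Li (m+1) (Complex.exp (-x * t) * e2pi α) *
      Li n (Complex.exp (-1 * t) * e2pi β)) (a := 0) (m := 0 * 0)
    ((u_cont0 m hm x _ hα hx).mul (u_cont0 n hn 1 _ hβ h1))
    (fun t ht => by
      refine ((u_hasDerivAt m hm x _ hα hx t ht).mul
        (u_hasDerivAt n hn 1 _ hβ h1 t ht)).congr_deriv ?_
      ring)
    ((I1.const_mul (-x)).sub I2)
    ((u_tendsto m hm x _ hα hx).mul (u_tendsto n hn 1 _ hβ h1))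
  rw [integral_sub (I1.const_mul (-x)) I2, integral_const_mul] at key
  simp only [Complex.ofReal_zero, mul_zero, Complex.exp_zero, one_mul, zero_sub] at key
  linear_combination (-x)^n * key

end
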